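/- arXiv:2011.03876 — 2 statements merged into one kernel-verified Lean document; each statement's English description precedes it below -/
import Mathlib

section
/- For every integer d ≥ 4 and every constant c > 0, there exists a real d×d matrix A such that (sgn(det A)·cof(A) − cof(I)) : (A − I) < −c·|A − I|², where I is the d×d identity matrix. In other words, the matrix inequality of the main lemma (with M = I, whose singular values all equal 1 and whose determinant equals 1) fails for every fixed constant in dimension d ≥ 4. -/
noncomputable section

open Matrix

/-- Frobenius inner product `A : B = ∑_{i,j} A_{ij} B_{ij}`. -/
def frobInner {d : ℕ} (A B : Matrix (Fin d) (Fin d) ℝ) : ℝ := ∑ i, ∑ j, A i j * B i j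

/-- Frobenius norm `|A| = √(A : A)`. -/
def frobNorm {d : ℕ} (A : Matrix (Fin d) (Fin d) ℝ) : ℝ := Real.sqrt (∑ i, ∑ j, (A i j) ^ 2)

/-- Cofactor matrix: the transpose of the adjugate, so that `Mᵀ * cof M = det M • 1`. -/
def cof {d : ℕ} (M : Matrix (Fin d) (Fin d) ℝ) : Matrix (Fin d) (Fin d) ℝ := (Matrix.adjugate M)ᵀ

theorem cof_diagonal_of_prod_eq_one {d : ℕ} (v : Fin d → ℝ) (hv : ∏ i, v i = 1) :
    cof (diagonal v) = diagonal fun i => (v i)⁻¹ := by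
  have hv0 : ∀ i, v i ≠ 0 := fun i hi => by
    rw [Finset.prod_eq_zero (Finset.mem_univ i) hi] at hv
    exact zero_ne_one hv
  have h : diagonal v * diagonal (fun i => (v i)⁻¹) = 1 := by
    rw [diagonal_mul_diagonal, ← diagonal_one]
    congr 1
    funext i
    exact mul_inv_cancel₀ (hv0 i)
  have hadj : adjugate (diagonal v) = diagonal fun i => (v i)⁻¹ := by
    rw [← Matrix.mul_one (adjugate (diagonal v)), ← h, ← Matrix.mul_assoc, adjugate_mul,
      det_diagonal, hv, one_smul, Matrix.one_mul]
  rw [cof, hadj, diagonal_transpose]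

theorem cof_one {d : ℕ} : cof (1 : Matrix (Fin d) (Fin d) ℝ) = 1 := by
  rw [cof, adjugate_one, transpose_one]

theorem frobInner_diagonal {d : ℕ} (v w : Fin d → ℝ) :
    frobInner (diagonal v) (diagonal w) = ∑ i, v i * w i := by
  simp [frobInner, diagonal_apply]

theorem frobNorm_sq {d : ℕ} (A : Matrix (Fin d) (Fin d) ℝ) :
    frobNorm A ^ 2 = frobInner A A := by
  rw [frobNorm, Real.sq_sqrt (by positivity), frobInner]
  simp only [sq]

/-- For a diagonal matrix of determinant one, the two sides of the matrix inequality are sums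
over the diagonal entries. -/
theorem frobInner_cof_sub_and_frobNorm_sq_diagonal {d : ℕ} (v : Fin d → ℝ)
    (hv : ∏ i, v i = 1) :
    frobInner (Real.sign (diagonal v).det • cof (diagonal v) - cof 1) (diagonal v - 1) =
        ∑ i, ((v i)⁻¹ - 1) * (v i - 1) ∧
      frobNorm (diagonal v - 1) ^ 2 = ∑ i, (v i - 1) * (v i - 1) := by
  rw [frobNorm_sq, det_diagonal, hv, Real.sign_one, one_smul, cof_one,
    cof_diagonal_of_prod_eq_one v hv, ← diagonal_one, diagonal_sub, diagonal_sub,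
    frobInner_diagonal, frobInner_diagonal]
  exact ⟨rfl, rfl⟩

theorem exists_stretch_dominates (n : ℕ) (hn : 3 ≤ n) (c : ℝ) (hc : 0 < c) :
    ∃ α : ℝ, 1 < α ∧
      n * ((α⁻¹ - 1) * (α - 1)) + (α ^ n - 1) * ((α ^ n)⁻¹ - 1) <
        -c * (n * ((α - 1) * (α - 1)) + ((α ^ n)⁻¹ - 1) * ((α ^ n)⁻¹ - 1)) := by
  have hn0 : (0 : ℝ) ≤ c * n := by positivity
  refine ⟨c * n + c + 3, by linarith, ?_⟩
  set α : ℝ := c * n + c + 3 with hα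
  have h1 : 1 < α := by linarith
  have hpow : α ^ 3 ≤ α ^ n := pow_le_pow_right₀ h1.le hn
  have hbpos : 0 < (α ^ n)⁻¹ := by positivity
  have hb1 : (α ^ n)⁻¹ ≤ 1 := inv_le_one_of_one_le₀ (one_le_pow₀ h1.le)
  have hmul : α ^ n * (α ^ n)⁻¹ = 1 := mul_inv_cancel₀ (by positivity)
  have hinv : α⁻¹ ≤ 1 := inv_le_one_of_one_le₀ h1.le
  have hfirst : n * ((α⁻¹ - 1) * (α - 1)) ≤ 0 :=
    mul_nonpos_of_nonneg_of_nonpos (Nat.cast_nonneg n)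
      (mul_nonpos_of_nonpos_of_nonneg (by linarith) (by linarith))
  have hsq : c * n * ((α - 1) * (α - 1)) ≤ c * n * α ^ 2 :=
    mul_le_mul_of_nonneg_left (by nlinarith) hn0
  have hlast : c * (((α ^ n)⁻¹ - 1) * ((α ^ n)⁻¹ - 1)) ≤ c * 1 :=
    mul_le_mul_of_nonneg_left (by nlinarith) hc.le
  have hcube : α ^ 3 = c * n * α ^ 2 + (c + 3) * α ^ 2 := by
    rw [show α ^ 3 = α * α ^ 2 by ring]
    nth_rewrite 1 [hα]
    ring
  have hrest : c + 3 ≤ (c + 3) * α ^ 2 :=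
    le_mul_of_one_le_right (by linarith) (one_le_pow₀ h1.le)
  linarith

/-- in every dimension `d ≥ 4` and for every constant `c > 0`, there exists a
real `d×d` matrix `A` such that `(sgn(det A)·cof A − cof I) : (A − I) < −c·|A − I|²`;
i.e. the matrix inequality of the main lemma (with `M = I`) fails for every fixed constant
when `d ≥ 4`. -/
theorem stmt_3 (d : ℕ) (hd : 4 ≤ d) (c : ℝ) (hc : 0 < c) :
    ∃ A : Matrix (Fin d) (Fin d) ℝ,
      frobInner (Real.sign A.det • cof A - cof 1) (A - 1) < -c * (frobNorm (A - 1)) ^ 2 := by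
  obtain ⟨n, rfl⟩ : ∃ n, d = n + 1 := ⟨d - 1, by omega⟩
  obtain ⟨α, h1, hlt⟩ := exists_stretch_dominates n (by omega) c hc
  let v : Fin (n + 1) → ℝ := Fin.snoc (fun _ => α) (α ^ n)⁻¹
  have hv : ∏ i, v i = 1 := by
    have : α ^ n ≠ 0 := by positivity
    simp [v, Fin.prod_univ_castSucc, this]
  obtain ⟨hinner, hnorm⟩ := frobInner_cof_sub_and_frobNorm_sq_diagonal v hv
  refine ⟨diagonal v, ?_⟩
  rw [hinner, hnorm]
  simpa only [v, Fin.sum_univ_castSucc, Fin.snoc_castSucc, Fin.snoc_last, Finset.sum_const,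
    Finset.card_univ, Fintype.card_fin, nsmul_eq_mul, inv_inv] using hlt
end
end

section
/- Let M and A be real 3×3 matrices and let σ > 0 satisfy ‖Mv‖ ≥ σ‖v‖ for every v ∈ ℝ³. Then, with c := 1 + (3/2)(1 + √3), |det A| − |det M| − sgn(det M)·cof(M) : (A − M) ≥ −(c / (2σ²))·|det M|·|A − M|². (Pointwise form of the Bregman divergence bound for the map B ↦ |det B|, obtained by integrating the matrix inequality along the segment from M to A.) -/
noncomputable section

open Matrix

/-- Pairing the cofactor matrix of `M` with `M * H` gives `det M * tr H`. -/
theorem frobInner_cof_mul {d : ℕ} (M H : Matrix (Fin d) (Fin d) ℝ) :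
    frobInner (cof M) (M * H) = M.det * H.trace := by
  have h : frobInner (cof M) (M * H) = (adjugate M * (M * H)).trace := by
    simp only [frobInner, cof, Matrix.trace, Matrix.diag, Matrix.mul_apply, transpose_apply]
    rw [Finset.sum_comm]
  rw [h, ← Matrix.mul_assoc, adjugate_mul, Matrix.smul_mul, Matrix.one_mul, trace_smul, smul_eq_mul]

/-- A lower bound on the singular values of `M` bounds `|M H|` from below. -/
theorem sq_mul_frobNorm_sq_le {d : ℕ} {M : Matrix (Fin d) (Fin d) ℝ} {σ : ℝ} (hσ : 0 ≤ σ)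
    (hM : ∀ v : EuclideanSpace ℝ (Fin d), σ * ‖v‖ ≤
      ‖(EuclideanSpace.equiv (Fin d) ℝ).symm (M.mulVec (EuclideanSpace.equiv (Fin d) ℝ v))‖)
    (H : Matrix (Fin d) (Fin d) ℝ) :
    σ ^ 2 * frobNorm H ^ 2 ≤ frobNorm (M * H) ^ 2 := by
  have key : ∀ B : Matrix (Fin d) (Fin d) ℝ, frobNorm B ^ 2 = ∑ j, ∑ i, B i j ^ 2 := fun B ↦ by
    rw [frobNorm, Real.sq_sqrt (by positivity), Finset.sum_comm]
  rw [key, key, Finset.mul_sum]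
  refine Finset.sum_le_sum fun j _ ↦ ?_
  have h := pow_le_pow_left₀ (by positivity) (hM (WithLp.toLp 2 fun i ↦ H i j)) 2
  rw [mul_pow, EuclideanSpace.real_norm_sq_eq, EuclideanSpace.real_norm_sq_eq] at h
  simpa [Matrix.mul_apply, mulVec, dotProduct] using h

/-- A matrix whose singular values are bounded below by a positive number is invertible. -/
theorem det_ne_zero_of_le_norm_mulVec {d : ℕ} {M : Matrix (Fin d) (Fin d) ℝ} {σ : ℝ} (hσ : 0 < σ)
    (hM : ∀ v : EuclideanSpace ℝ (Fin d), σ * ‖v‖ ≤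
      ‖(EuclideanSpace.equiv (Fin d) ℝ).symm (M.mulVec (EuclideanSpace.equiv (Fin d) ℝ v))‖) :
    M.det ≠ 0 := by
  intro h
  obtain ⟨v, hv, hMv⟩ := exists_mulVec_eq_zero_iff.mpr h
  have h1 := hM ((EuclideanSpace.equiv (Fin d) ℝ).symm v)
  rw [ContinuousLinearEquiv.apply_symm_apply, hMv, map_zero, norm_zero] at h1
  have h2 : ‖(EuclideanSpace.equiv (Fin d) ℝ).symm v‖ ≤ 0 := by
    by_contra! h3
    exact absurd h1 (not_le.mpr (mul_pos hσ h3))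
  exact hv (by simpa using h2)

/-- A scalar form of Hadamard's inequality for three vectors in `ℝ³`. -/
theorem det_fin_three_sq_le (a b c d e f g h i : ℝ) :
    (a * (e * i - f * h) - b * (d * i - f * g) + c * (d * h - e * g)) ^ 2 ≤
      (a ^ 2 + b ^ 2 + c ^ 2) * ((d ^ 2 + e ^ 2 + f ^ 2) * (g ^ 2 + h ^ 2 + i ^ 2)) := by
  have h1 : (e * i - f * h) ^ 2 + (d * i - f * g) ^ 2 + (d * h - e * g) ^ 2 ≤
      (d ^ 2 + e ^ 2 + f ^ 2) * (g ^ 2 + h ^ 2 + i ^ 2) := by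
    nlinarith [sq_nonneg (d * g + e * h + f * i)]
  refine le_trans ?_ (mul_le_mul_of_nonneg_left h1 (by positivity))
  generalize e * i - f * h = x, d * i - f * g = y, d * h - e * g = z
  nlinarith [sq_nonneg (a * y + b * x), sq_nonneg (a * z - c * x), sq_nonneg (b * z + c * y)]

/-- The Bregman divergence bound for `B ↦ |det B|` at the identity. -/
theorem abs_det_one_add_ge (H : Matrix (Fin 3) (Fin 3) ℝ) :
    -(5 / 2) * frobNorm H ^ 2 ≤ |(1 + H).det| - 1 - H.trace := by
  rw [frobNorm, Real.sq_sqrt (by positivity)]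
  simp only [det_fin_three, trace_fin_three, Fin.sum_univ_three, Matrix.add_apply, Matrix.one_apply]
  simp only [Fin.isValue, Fin.reduceEq, if_true, if_false, zero_add]
  generalize H 0 0 = a, H 0 1 = b, H 0 2 = c, H 1 0 = d, H 1 1 = e, H 1 2 = f,
    H 2 0 = g, H 2 1 = h, H 2 2 = i
  obtain ⟨s, hs⟩ : ∃ s, s = a ^ 2 + b ^ 2 + c ^ 2 + (d ^ 2 + e ^ 2 + f ^ 2) +
    (g ^ 2 + h ^ 2 + i ^ 2) := ⟨_, rfl⟩
  rw [← hs]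
  rcases le_total s 4 with h4 | h4
  · have hs0 : 0 ≤ s := by rw [hs]; positivity
    have hdet := det_fin_three_sq_le a b c d e f g h i
    have hp : (a ^ 2 + b ^ 2 + c ^ 2) * ((d ^ 2 + e ^ 2 + f ^ 2) * (g ^ 2 + h ^ 2 + i ^ 2)) ≤
        s * (s * s) := by
      gcongr <;> rw [hs] <;>
        linarith [sq_nonneg a, sq_nonneg b, sq_nonneg c, sq_nonneg d, sq_nonneg e, sq_nonneg f,
          sq_nonneg g, sq_nonneg h, sq_nonneg i]
    have hss : s * (s * s) ≤ (2 * s) ^ 2 := by nlinarith [mul_nonneg hs0 hs0]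
    have hd := (abs_le_of_sq_le_sq' (hdet.trans (hp.trans hss)) (by positivity)).1
    refine le_trans ?_ (sub_le_sub_right (sub_le_sub_right (le_abs_self _) _) _)
    nlinarith [sq_nonneg (a + e + i), sq_nonneg (b - d), sq_nonneg (c - g), sq_nonneg (f - h)]
  · refine le_trans ?_ (sub_le_sub_right (sub_le_sub_right (abs_nonneg _) _) _)
    nlinarith [sq_nonneg (a - 1), sq_nonneg (e - 1), sq_nonneg (i - 1), sq_nonneg b, sq_nonneg c,
      sq_nonneg d, sq_nonneg f, sq_nonneg g, sq_nonneg h]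


/-- pointwise Bregman-divergence bound for `B ↦ |det B|` in three dimensions.
If every singular value of `M` is at least `σ > 0`, then with `c := 1 + (3/2)(1 + √3)`,
`|det A| − |det M| − sgn(det M)·cof M : (A − M) ≥ −(c/(2σ²))·|det M|·|A − M|²`. -/
theorem stmt_7 (M A : Matrix (Fin 3) (Fin 3) ℝ) (σ : ℝ) (hσ : 0 < σ)
    (hM : ∀ v : EuclideanSpace ℝ (Fin 3), σ * ‖v‖ ≤
      ‖(EuclideanSpace.equiv (Fin 3) ℝ).symm (M.mulVec (EuclideanSpace.equiv (Fin 3) ℝ v))‖) :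
    |A.det| - |M.det| - Real.sign M.det * frobInner (cof M) (A - M)
      ≥ -((1 + (3 / 2) * (1 + Real.sqrt 3)) / (2 * σ ^ 2)) * |M.det|
          * (frobNorm (A - M)) ^ 2 := by
  have hdet := det_ne_zero_of_le_norm_mulVec hσ hM
  obtain ⟨H, hH⟩ : ∃ H, A - M = M * H :=
    ⟨M⁻¹ * (A - M), (mul_nonsing_inv_cancel_left M _ hdet.isUnit).symm⟩
  have hA : A = M * (1 + H) := by rw [Matrix.mul_add, Matrix.mul_one, ← hH]; abel
  have hsign : Real.sign M.det * M.det = |M.det| := by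
    rcases hdet.lt_or_gt with h | h
    · rw [Real.sign_of_neg h, abs_of_neg h, neg_one_mul]
    · rw [Real.sign_of_pos h, abs_of_pos h, one_mul]
  have hnorm : frobNorm H ^ 2 ≤ frobNorm (M * H) ^ 2 / σ ^ 2 := by
    rw [le_div_iff₀' (by positivity)]
    exact sq_mul_frobNorm_sq_le hσ.le hM H
  have hsqrt : (5 / 3 : ℝ) ≤ √3 := Real.le_sqrt_of_sq_le (by norm_num)
  rw [hH, frobInner_cof_mul, ← mul_assoc, hsign, hA, det_mul, abs_mul]
  have hbound : -((1 + (3 / 2) * (1 + √3)) / 2) * (frobNorm (M * H) ^ 2 / σ ^ 2) ≤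
      |(1 + H).det| - 1 - H.trace := by
    have hpos : 0 ≤ frobNorm (M * H) ^ 2 / σ ^ 2 := by positivity
    nlinarith [abs_det_one_add_ge H]
  calc
    _ = |M.det| * (-((1 + (3 / 2) * (1 + √3)) / 2) * (frobNorm (M * H) ^ 2 / σ ^ 2)) := by
      field_simp
    _ ≤ |M.det| * (|(1 + H).det| - 1 - H.trace) := by gcongr
    _ = _ := by ring
end
end
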